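/- Let d ≥ 1, let V : ℝ^d → ℝ be continuous with Z_V := ∫ e^{−V} < ∞ and Z_{2V} := ∫ e^{−2V} < ∞, let t > 0, z ∈ ℝ^d, and let y_1, …, y_n be i.i.d. samples from N(0, (1−e^{−2t}) I_d). Define N̂ := −(1/(n(1−e^{−2t}))) Σ_{i=1}^n y_i e^{−V(e^t(z−y_i))}, D̂ := (1/n) Σ_{i=1}^n e^{−V(e^t(z−y_i))}, N := E[N̂] and D := E[D̂]. Then E[‖N̂ − N‖²] ≤ (1/n) · p_t^{2V}(z) Z_{2V} e^{−td} · (Δ log p_t^{2V}(z) + d/(1−e^{−2t}) + ‖∇ log p_t^{2V}(z)‖²), and E[(D̂ − D)²] ≤ (1/n) · p_t^{2V}(z) Z_{2V} e^{−td}. -/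

import Mathlib

open Real MeasureTheory
open scoped RealInnerProductSpace

/-- The forward Ornstein–Uhlenbeck density at time `t`, started at `μ = e^{-W}/∫ e^{-W}`. -/
noncomputable def ouDensity (d : ℕ) (W : EuclideanSpace ℝ (Fin d) → ℝ) (t : ℝ)
    (z : EuclideanSpace ℝ (Fin d)) : ℝ :=
  (2 * π * (1 - exp (-2 * t))) ^ (-(d : ℝ) / 2) *
    ∫ x : EuclideanSpace ℝ (Fin d),
      exp (-‖z - exp (-t) • x‖ ^ 2 / (2 * (1 - exp (-2 * t)))) *
        (exp (-W x) / ∫ y : EuclideanSpace ℝ (Fin d), exp (-W y))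

/-- The density of the centered Gaussian `N(0, s I_d)` on `ℝ^d`. -/
noncomputable def gaussDens (d : ℕ) (s : ℝ) (y : EuclideanSpace ℝ (Fin d)) : ℝ :=
  (2 * π * s) ^ (-(d : ℝ) / 2) * exp (-‖y‖ ^ 2 / (2 * s))

/-- The empirical numerator `N̂ = -(1/(n(1-e^{-2t}))) ∑ᵢ yᵢ e^{-V(e^t(z-yᵢ))}`. -/
noncomputable def hatN (d n : ℕ) (V : EuclideanSpace ℝ (Fin d) → ℝ) (t : ℝ)
    (z : EuclideanSpace ℝ (Fin d)) (y : Fin n → EuclideanSpace ℝ (Fin d)) :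
    EuclideanSpace ℝ (Fin d) :=
  (-(1 / (n * (1 - exp (-2 * t))))) • ∑ i, exp (-V (exp t • (z - y i))) • y i

/-- The empirical denominator `D̂ = (1/n) ∑ᵢ e^{-V(e^t(z-yᵢ))}`. -/
noncomputable def hatD (d n : ℕ) (V : EuclideanSpace ℝ (Fin d) → ℝ) (t : ℝ)
    (z : EuclideanSpace ℝ (Fin d)) (y : Fin n → EuclideanSpace ℝ (Fin d)) : ℝ :=
  (1 / n) * ∑ i, exp (-V (exp t • (z - y i)))

/-- A product of measures with densities has the product density. -/
theorem pi_withDensity_ofReal {ι E : Type*} [Fintype ι] [MeasurableSpace E] (ν : Measure E)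
    [SigmaFinite ν] {g : E → ℝ} (hg : Integrable g ν) (hg0 : ∀ x, 0 ≤ g x) :
    Measure.pi (fun _ : ι => ν.withDensity fun x => ENNReal.ofReal (g x)) =
      (Measure.pi fun _ : ι => ν).withDensity fun y => ENNReal.ofReal (∏ i, g (y i)) := by
  have : IsFiniteMeasure (ν.withDensity fun x => ENNReal.ofReal (g x)) :=
    isFiniteMeasure_withDensity_ofReal hg.2
  refine Measure.pi_eq fun s hs => ?_
  rw [withDensity_apply _ (MeasurableSet.univ_pi hs), Measure.restrict_pi_pi,
    ← ofReal_integral_eq_lintegral_ofReal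
      (Integrable.fintype_prod (f := fun _ : ι => g) fun i => hg.restrict)
      (Filter.Eventually.of_forall fun y => Finset.prod_nonneg fun i _ => hg0 _),
    integral_fintype_prod_eq_prod (μ := fun i => ν.restrict (s i)) (fun _ : ι => g),
    ENNReal.ofReal_prod_of_nonneg fun i _ => integral_nonneg hg0]
  refine Finset.prod_congr rfl fun i _ => ?_
  rw [withDensity_apply _ (hs i), ofReal_integral_eq_lintegral_ofReal hg.restrict
    (Filter.Eventually.of_forall hg0)]

/-- The variance of a normalised sum of i.i.d. copies is at most the normalised second moment. -/
theorem lintegral_sq_sub_mean_le {E : Type*} [MeasurableSpace E] (ρ : Measure E)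
    [IsProbabilityMeasure ρ] {f : E → ℝ} (hf : MemLp f 2 ρ) (n : ℕ) (c : ℝ) :
    ∫⁻ y : Fin n → E, ENNReal.ofReal
        ((c * ∑ i, f (y i) - ∫ y' : Fin n → E, c * ∑ i, f (y' i) ∂Measure.pi fun _ => ρ) ^ 2)
        ∂(Measure.pi fun _ => ρ) ≤
      ENNReal.ofReal (c ^ 2 * n * ∫ x, f x ^ 2 ∂ρ) := by
  have hL : ∀ i : Fin n, MemLp (fun y : Fin n → E => f (y i)) 2 (Measure.pi fun _ => ρ) :=
    fun i => hf.comp_measurePreserving (measurePreserving_eval (fun _ : Fin n => ρ) i)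
  have hS : MemLp (fun y : Fin n → E => c * ∑ i, f (y i)) 2 (Measure.pi fun _ => ρ) :=
    (memLp_finsetSum _ fun i _ => hL i).const_mul c
  rw [← ProbabilityTheory.evariance_eq_lintegral_ofReal, ← ProbabilityTheory.ofReal_variance hS]
  refine ENNReal.ofReal_le_ofReal ?_
  rw [ProbabilityTheory.variance_const_mul]
  have h1 := ProbabilityTheory.variance_sum_pi (μ := fun _ : Fin n => ρ) (X := fun _ => f)
    fun _ => hf
  have h2 : (∑ i : Fin n, fun ω : Fin n → E => f (ω i)) = fun ω => ∑ i, f (ω i) := by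
    ext ω; simp
  rw [h2] at h1
  rw [h1, Finset.sum_const, Finset.card_univ, Fintype.card_fin, nsmul_eq_mul, mul_assoc]
  gcongr
  exact ProbabilityTheory.variance_le_expectation_sq hf.1

/-- The mean square deviation of a normalised sum of i.i.d. random vectors is at most the
normalised second moment. -/
theorem lintegral_norm_sq_sub_mean_le {E : Type*} [MeasurableSpace E] (ρ : Measure E)
    [IsProbabilityMeasure ρ] {d : ℕ} {f : E → EuclideanSpace ℝ (Fin d)} (hfm : Measurable f)
    (hf : Integrable (fun x => ‖f x‖ ^ 2) ρ) (n : ℕ) (c : ℝ) :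
    ∫⁻ y : Fin n → E, ENNReal.ofReal
        (‖c • ∑ i, f (y i) - ∫ y' : Fin n → E, c • ∑ i, f (y' i) ∂Measure.pi fun _ => ρ‖ ^ 2)
        ∂(Measure.pi fun _ => ρ) ≤
      ENNReal.ofReal (c ^ 2 * n * ∫ x, ‖f x‖ ^ 2 ∂ρ) := by
  have hf2 : MemLp f 2 ρ := (memLp_two_iff_integrable_sq_norm hfm.aestronglyMeasurable).2 hf
  have hfj : ∀ j, MemLp (fun x => f x j) 2 ρ := fun j =>
    (EuclideanSpace.proj (𝕜 := ℝ) j).comp_memLp' hf2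
  have hint : Integrable (fun y : Fin n → E => c • ∑ i, f (y i)) (Measure.pi fun _ => ρ) :=
    (integrable_finsetSum _ fun i _ => integrable_comp_eval
      (μ := fun _ : Fin n => ρ) (i := i) (hf2.integrable one_le_two)).smul c
  have hmean : ∀ j, (∫ y : Fin n → E, c • ∑ i, f (y i) ∂Measure.pi fun _ => ρ) j =
      ∫ y : Fin n → E, c * ∑ i, f (y i) j ∂Measure.pi fun _ => ρ := fun j => by
    simpa using (ContinuousLinearMap.integral_comp_comm (EuclideanSpace.proj (𝕜 := ℝ) j) hint).symm
  simp_rw [EuclideanSpace.real_norm_sq_eq]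
  simp only [PiLp.sub_apply, PiLp.smul_apply, hmean, smul_eq_mul]
  simp only [WithLp.ofLp_sum, Finset.sum_apply]
  rw [integral_finsetSum _ fun j _ => (hfj j).integrable_sq, Finset.mul_sum,
    ENNReal.ofReal_sum_of_nonneg fun j _ => by positivity]
  simp_rw [ENNReal.ofReal_sum_of_nonneg fun j _ => sq_nonneg _]
  rw [lintegral_finsetSum _ fun j _ => by fun_prop]
  exact Finset.sum_le_sum fun j _ => lintegral_sq_sub_mean_le ρ (hfj j) n c

section Convolution

variable {E F : Type*} [NormedAddCommGroup E] [NormedSpace ℝ E] [MeasurableSpace E] [BorelSpace E]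
  [SecondCountableTopology E] [NormedAddCommGroup F] [NormedSpace ℝ F] {ν : Measure E} {h : E → ℝ}

theorem MeasureTheory.Integrable.smul_comp_sub_smul (hh : Integrable h ν) {φ : E → F}
    (hφ : Continuous φ) {A : ℝ} (hA : ∀ u, ‖φ u‖ ≤ A) (a : ℝ) (w : E) :
    Integrable (fun x => h x • φ (w - a • x)) ν := by
  refine (hh.norm.mul_const A).mono' (hh.aestronglyMeasurable.smul
    (hφ.comp (by fun_prop : Continuous fun x : E => w - a • x)).aestronglyMeasurable)
    (Filter.Eventually.of_forall fun x => ?_)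
  rw [norm_smul]
  gcongr
  exact hA _

/-- Differentiation under the integral sign of an integrable function against rescaled translates
of a bounded function with bounded continuous derivative. -/
theorem hasFDerivAt_integral_smul_sub (hh : Integrable h ν) {φ : E → F} {φ' : E → E →L[ℝ] F}
    (hφ : ∀ u, HasFDerivAt φ (φ' u) u) (hφ' : Continuous φ') {A B : ℝ} (hA : ∀ u, ‖φ u‖ ≤ A)
    (hB : ∀ u, ‖φ' u‖ ≤ B) (a : ℝ) (w : E) :
    HasFDerivAt (fun w => ∫ x, h x • φ (w - a • x) ∂ν) (∫ x, h x • φ' (w - a • x) ∂ν) w := by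
  have hφc : Continuous φ := continuous_iff_continuousAt.2 fun u => (hφ u).continuousAt
  refine hasFDerivAt_integral_of_dominated_of_fderiv_le (s := Set.univ)
    (F' := fun w x => h x • φ' (w - a • x)) (bound := fun x => ‖h x‖ * B) Filter.univ_mem
    (Filter.Eventually.of_forall fun w =>
      (hh.smul_comp_sub_smul hφc hA a w).aestronglyMeasurable)
    (hh.smul_comp_sub_smul hφc hA a w)
    (hh.smul_comp_sub_smul hφ' hB a w).aestronglyMeasurable
    (Filter.Eventually.of_forall fun x w _ => ?_) (hh.norm.mul_const B)
    (Filter.Eventually.of_forall fun x w _ => ?_)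
  · rw [norm_smul]
    gcongr
    exact hB _
  · exact ((hφ _).comp w ((hasFDerivAt_id w).sub_const (a • x))).const_smul (h x)

end Convolution

theorem gauss_le_one {E : Type*} [NormedAddCommGroup E] {s : ℝ} (hs : 0 < s) (u : E) :
    exp (-‖u‖ ^ 2 / (2 * s)) ≤ 1 := by
  rw [exp_le_one_iff, neg_div]
  exact neg_nonpos.2 (by positivity)

theorem gauss_mul_norm_sq_le {E : Type*} [NormedAddCommGroup E] {s : ℝ} (hs : 0 < s) (u : E) :
    exp (-‖u‖ ^ 2 / (2 * s)) * ‖u‖ ^ 2 ≤ 2 * s := by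
  rw [neg_div, exp_neg, inv_mul_le_iff₀ (exp_pos _), ← div_le_iff₀ (by positivity)]
  linarith [add_one_le_exp (‖u‖ ^ 2 / (2 * s))]

theorem gauss_mul_norm_le {E : Type*} [NormedAddCommGroup E] {s : ℝ} (hs : 0 < s) (u : E) :
    exp (-‖u‖ ^ 2 / (2 * s)) * ‖u‖ ≤ 1 + 2 * s := by
  nlinarith [gauss_mul_norm_sq_le hs u, gauss_le_one hs u, exp_pos (-‖u‖ ^ 2 / (2 * s)),
    mul_nonneg (exp_pos (-‖u‖ ^ 2 / (2 * s))).le (sq_nonneg (‖u‖ - 1)), norm_nonneg u]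

section Gaussian

variable {E : Type*} [NormedAddCommGroup E] [InnerProductSpace ℝ E]
  {G : Type*} [NormedAddCommGroup G] [NormedSpace ℝ G]

/-- The real inner product as a continuous bilinear map. -/
noncomputable def realInner : E →L[ℝ] E →L[ℝ] ℝ := innerSL ℝ

@[simp] theorem realInner_apply (u v : E) : realInner u v = ⟪u, v⟫ := rfl

theorem norm_realInner_apply (u : E) : ‖realInner u‖ = ‖u‖ := innerSL_apply_norm ℝ u

theorem norm_realInner_le : ‖(realInner : E →L[ℝ] E →L[ℝ] ℝ)‖ ≤ 1 := norm_innerSL_le ℝ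

/-- The derivative of the Gaussian profile `u ↦ exp (-‖u‖² / (2 s))`. -/
noncomputable def gaussDeriv (s : ℝ) (u : E) : E →L[ℝ] ℝ :=
  (-(exp (-‖u‖ ^ 2 / (2 * s)) / s)) • realInner u

/-- The derivative of `u ↦ -(exp (-‖u‖² / (2 s)) / s) • L u` for a continuous linear map `L`. -/
noncomputable def gaussSmulDeriv (s : ℝ) (L : E →L[ℝ] G) (u : E) : E →L[ℝ] G :=
  (-(exp (-‖u‖ ^ 2 / (2 * s)) / s)) • L +
    (exp (-‖u‖ ^ 2 / (2 * s)) / s ^ 2) • (realInner u).smulRight (L u)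

theorem gaussSmulDeriv_apply (s : ℝ) (L : E →L[ℝ] G) (u v : E) :
    gaussSmulDeriv s L u v = (-(exp (-‖u‖ ^ 2 / (2 * s)) / s)) • L v +
      (exp (-‖u‖ ^ 2 / (2 * s)) / s ^ 2 * ⟪u, v⟫) • L u := by
  simp [gaussSmulDeriv, mul_smul]

theorem hasFDerivAt_gauss (s : ℝ) (u : E) :
    HasFDerivAt (fun u : E => exp (-‖u‖ ^ 2 / (2 * s))) (gaussDeriv s u) u := by
  have h := ((hasStrictFDerivAt_norm_sq u).hasFDerivAt.const_mul (-(2 * s)⁻¹)).exp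
  refine (h.congr_fderiv ?_).congr_of_eventuallyEq (Filter.Eventually.of_forall fun v => ?_)
  · ext v
    simp [gaussDeriv]
    ring_nf
  · simp only
    ring_nf

theorem hasFDerivAt_gauss_smul (s : ℝ) (L : E →L[ℝ] G) (u : E) :
    HasFDerivAt (fun u => (-(exp (-‖u‖ ^ 2 / (2 * s)) / s)) • L u) (gaussSmulDeriv s L u) u := by
  have h := (((hasFDerivAt_gauss s u).mul_const s⁻¹).neg).smul L.hasFDerivAt
  refine (h.congr_fderiv ?_).congr_of_eventuallyEq (Filter.Eventually.of_forall fun v => ?_)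
  · ext v
    simp only [gaussSmulDeriv, gaussDeriv, add_apply, smul_apply,
      ContinuousLinearMap.smulRight_apply, neg_apply, Pi.neg_apply,
      realInner_apply, smul_eq_mul, smul_smul]
    congr 2
    ring
  · simp [div_eq_mul_inv]

theorem continuous_gaussSmulDeriv (s : ℝ) (L : E →L[ℝ] G) :
    Continuous (gaussSmulDeriv s L) := by
  have h : Continuous fun u : E => (realInner u).smulRight (L u) :=
    ((ContinuousLinearMap.smulRightL ℝ E G).continuous.comp
      realInner.continuous).clm_apply L.continuous
  unfold gaussSmulDeriv
  fun_prop

theorem continuous_gaussDeriv (s : ℝ) : Continuous (gaussDeriv s : E → E →L[ℝ] ℝ) :=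
  continuous_iff_continuousAt.2 fun u => (hasFDerivAt_gauss_smul s realInner u).continuousAt

theorem norm_gaussDeriv_le {s : ℝ} (hs : 0 < s) (u : E) :
    ‖gaussDeriv s u‖ ≤ (1 + 2 * s) / s := by
  rw [gaussDeriv, norm_smul, norm_realInner_apply, norm_neg, norm_div,
    norm_of_nonneg (exp_pos _).le, norm_of_nonneg hs.le, div_mul_eq_mul_div]
  gcongr
  exact gauss_mul_norm_le hs u

theorem norm_gaussSmulDeriv_le {s : ℝ} (hs : 0 < s) {L : E →L[ℝ] G} (hL : ‖L‖ ≤ 1) (u : E) :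
    ‖gaussSmulDeriv s L u‖ ≤ 1 / s + 2 * s / s ^ 2 := by
  rw [gaussSmulDeriv]
  refine (norm_add_le _ _).trans (add_le_add ?_ ?_)
  · rw [norm_smul, norm_neg, norm_div, norm_of_nonneg (exp_pos _).le, norm_of_nonneg hs.le]
    refine (mul_le_of_le_one_right (by positivity) hL).trans ?_
    gcongr
    exact gauss_le_one hs u
  · rw [norm_smul, ContinuousLinearMap.norm_smulRight_apply, norm_realInner_apply, norm_div,
      norm_of_nonneg (exp_pos _).le, norm_of_nonneg (by positivity), div_mul_eq_mul_div]
    refine div_le_div_of_nonneg_right ?_ (sq_nonneg s)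
    refine le_trans ?_ (gauss_mul_norm_sq_le hs u)
    rw [sq]
    gcongr
    exact (L.le_opNorm u).trans (mul_le_of_le_one_left (norm_nonneg u) hL)

theorem sum_gaussSmulDeriv_realInner {ι : Type*} [Fintype ι] (b : OrthonormalBasis ι ℝ E) (s : ℝ)
    (u : E) :
    ∑ i, gaussSmulDeriv s realInner u (b i) (b i) =
      exp (-‖u‖ ^ 2 / (2 * s)) * (‖u‖ ^ 2 / s ^ 2 - Fintype.card ι / s) := by
  have h : ∑ i, ⟪u, b i⟫ * ⟪u, b i⟫ = ‖u‖ ^ 2 := by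
    simp_rw [← b.sum_sq_inner_right u, sq, real_inner_comm]
  simp only [gaussSmulDeriv_apply, add_apply, smul_apply, realInner_apply, smul_eq_mul,
    Finset.sum_add_distrib, mul_assoc, ← Finset.mul_sum, h, real_inner_self_eq_norm_sq,
    b.norm_eq_one]
  simp
  ring

end Gaussian

/-- For positive `p`, the identity `Δ log p + ‖∇ log p‖² = Δ p / p`, in an orthonormal basis. -/
theorem sum_iteratedFDeriv_log_add_norm_gradient_sq {ι E : Type*} [Fintype ι]
    [NormedAddCommGroup E] [InnerProductSpace ℝ E] [CompleteSpace E] (b : OrthonormalBasis ι ℝ E)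
    {p : E → ℝ} {p' : E → E →L[ℝ] ℝ} {p'' : E →L[ℝ] E →L[ℝ] ℝ} {z : E} (hpos : ∀ w, 0 < p w)
    (hp : ∀ w, HasFDerivAt p (p' w) w) (hp' : HasFDerivAt p' p'' z) :
    (∑ i, iteratedFDeriv ℝ 2 (fun w => Real.log (p w)) z ![b i, b i]) +
      ‖gradient (fun w => Real.log (p w)) z‖ ^ 2 = (∑ i, p'' (b i) (b i)) / p z := by
  have h1 : fderiv ℝ (fun w => Real.log (p w)) = fun w => (p w)⁻¹ • p' w :=
    funext fun w => ((hp w).log (hpos w).ne').fderiv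
  have h2 := ((hasDerivAt_inv (hpos z).ne').comp_hasFDerivAt z (hp z)).smul hp'
  have h3 : ‖gradient (fun w => Real.log (p w)) z‖ ^ 2 = ∑ i, ((p z)⁻¹ * p' z (b i)) ^ 2 := by
    rw [← b.sum_sq_inner_right]
    refine Finset.sum_congr rfl fun i _ => ?_
    rw [real_inner_comm, gradient, InnerProductSpace.toDual_symm_apply, h1]
    rfl
  rw [h3, ← Finset.sum_add_distrib, Finset.sum_div]
  refine Finset.sum_congr rfl fun i _ => ?_
  rw [iteratedFDeriv_two_apply, h1]
  erw [h2.fderiv]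
  simp
  field_simp [(hpos z).ne']
  ring

/-- The change of variables `x = c (z - y)`. -/
theorem integral_mul_comp_smul_sub {d : ℕ} {c : ℝ} (hc : 0 < c)
    (ψ W : EuclideanSpace ℝ (Fin d) → ℝ) (z : EuclideanSpace ℝ (Fin d)) :
    ∫ y, ψ y * W (c • (z - y)) = (c ^ d)⁻¹ * ∫ x, W x * ψ (z - c⁻¹ • x) := by
  rw [← integral_sub_left_eq_self (fun y => ψ y * W (c • (z - y))) volume z]
  have h := Measure.integral_comp_smul volume (fun x => W x * ψ (z - c⁻¹ • x)) c
  rw [finrank_euclideanSpace_fin, abs_of_pos (by positivity), smul_eq_mul] at h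
  rw [← h]
  refine integral_congr_ae (Filter.Eventually.of_forall fun y => ?_)
  simp [smul_smul, hc.ne', mul_comm]

theorem integrable_mul_comp_smul_sub {d : ℕ} {c : ℝ} (hc : 0 < c)
    {ψ W : EuclideanSpace ℝ (Fin d) → ℝ} (z : EuclideanSpace ℝ (Fin d))
    (h : Integrable fun x => W x * ψ (z - c⁻¹ • x)) :
    Integrable fun y => ψ y * W (c • (z - y)) := by
  have h' := (h.comp_smul hc.ne').comp_sub_left z
  refine h'.congr (Filter.Eventually.of_forall fun y => ?_)
  simp [smul_smul, hc.ne', mul_comm]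

theorem ouVariance_pos {t : ℝ} (ht : 0 < t) : 0 < 1 - exp (-2 * t) := by
  rw [sub_pos, exp_lt_one_iff]
  linarith

theorem ouDensity_mul_laplacian_log {d : ℕ} {W : EuclideanSpace ℝ (Fin d) → ℝ}
    (hW : Integrable fun x => exp (-W x)) {t : ℝ} (ht : 0 < t) (z : EuclideanSpace ℝ (Fin d)) :
    ouDensity d W t z *
        ((∑ i : Fin d, iteratedFDeriv ℝ 2 (fun w => Real.log (ouDensity d W t w)) z
            ![EuclideanSpace.single i 1, EuclideanSpace.single i 1]) +
          d / (1 - exp (-2 * t)) + ‖gradient (fun w => Real.log (ouDensity d W t w)) z‖ ^ 2) =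
      (2 * π * (1 - exp (-2 * t))) ^ (-(d : ℝ) / 2) *
        ∫ x, (exp (-‖z - exp (-t) • x‖ ^ 2 / (2 * (1 - exp (-2 * t)))) *
          (‖z - exp (-t) • x‖ ^ 2 / (1 - exp (-2 * t)) ^ 2)) * (exp (-W x) / ∫ y, exp (-W y)) := by
  have hs := ouVariance_pos ht
  unfold ouDensity
  set s := 1 - exp (-2 * t)
  set a := exp (-t)
  set Z := ∫ y, exp (-W y)
  set K := (2 * π * s) ^ (-(d : ℝ) / 2)
  have hZ : 0 < Z := integral_exp_pos hW
  have hK : 0 < K := by positivity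
  have hφ : Continuous fun u : EuclideanSpace ℝ (Fin d) => exp (-‖u‖ ^ 2 / (2 * s)) := by fun_prop
  have hφ1 : ∀ u : EuclideanSpace ℝ (Fin d), ‖exp (-‖u‖ ^ 2 / (2 * s))‖ ≤ 1 := fun u => by
    rw [norm_of_nonneg (exp_pos _).le]
    exact gauss_le_one hs u
  have hh : Integrable fun x => K * (exp (-W x) / Z) := (hW.div_const Z).const_mul K
  have hp : ∀ w, K * ∫ x, exp (-‖w - a • x‖ ^ 2 / (2 * s)) * (exp (-W x) / Z) =
      ∫ x, (K * (exp (-W x) / Z)) • exp (-‖w - a • x‖ ^ 2 / (2 * s)) := fun w => by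
    rw [← integral_const_mul]
    congr 1 with x
    rw [smul_eq_mul]
    ring
  simp_rw [hp]
  have hpos : ∀ w, 0 < ∫ x, (K * (exp (-W x) / Z)) • exp (-‖w - a • x‖ ^ 2 / (2 * s)) :=
    fun w => by
      have hi := hh.smul_comp_sub_smul hφ hφ1 a w
      have h0 : ∀ x, 0 < (K * (exp (-W x) / Z)) • exp (-‖w - a • x‖ ^ 2 / (2 * s)) :=
        fun x => by rw [smul_eq_mul]; positivity
      rw [integral_pos_iff_support_of_nonneg (fun x => (h0 x).le) hi,
        Function.support_eq_univ fun x => (h0 x).ne']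
      exact isOpen_univ.measure_pos volume Set.univ_nonempty
  have hL : ‖(realInner : EuclideanSpace ℝ (Fin d) →L[ℝ] _)‖ ≤ 1 := norm_realInner_le
  have key := sum_iteratedFDeriv_log_add_norm_gradient_sq (EuclideanSpace.basisFun (Fin d) ℝ)
    hpos
    (hasFDerivAt_integral_smul_sub hh (hasFDerivAt_gauss s) (continuous_gaussDeriv s) hφ1
      (norm_gaussDeriv_le hs) a)
    (hasFDerivAt_integral_smul_sub hh (hasFDerivAt_gauss_smul s realInner)
      (continuous_gaussSmulDeriv s _) (norm_gaussDeriv_le hs) (norm_gaussSmulDeriv_le hs hL) a z)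
  simp only [EuclideanSpace.basisFun_apply] at key
  rw [add_right_comm, key, mul_add, mul_div_cancel₀ _ (hpos z).ne', ← integral_mul_const]
  have hI := hh.smul_comp_sub_smul (continuous_gaussSmulDeriv s
    (realInner : EuclideanSpace ℝ (Fin d) →L[ℝ] _)) (norm_gaussSmulDeriv_le hs hL) a z
  have hI1 : ∀ v, Integrable fun x =>
      ((K * (exp (-W x) / Z)) • gaussSmulDeriv s realInner (z - a • x)) v :=
    fun v => hI.apply_continuousLinearMap v
  have hI2 : ∀ v, Integrable fun x =>
      ((K * (exp (-W x) / Z)) • gaussSmulDeriv s realInner (z - a • x)) v v :=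
    fun v => (hI1 v).apply_continuousLinearMap v
  simp_rw [ContinuousLinearMap.integral_apply hI, ContinuousLinearMap.integral_apply (hI1 _)]
  rw [← integral_finsetSum _ fun i _ => hI2 _, ← integral_add
    (integrable_finsetSum _ fun i _ => hI2 _) ((hh.smul_comp_sub_smul hφ hφ1 a z).mul_const _),
    ← integral_const_mul]
  refine integral_congr_ae (Filter.Eventually.of_forall fun x => ?_)
  have hsum := sum_gaussSmulDeriv_realInner (EuclideanSpace.basisFun (Fin d) ℝ) s (z - a • x)
  simp only [EuclideanSpace.basisFun_apply, Fintype.card_fin] at hsum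
  simp only [smul_apply, smul_eq_mul, ← Finset.mul_sum, hsum]
  ring

theorem lintegral_ofReal_mul_eq {α : Type*} [MeasurableSpace α] (ν : Measure α) {G : α → ℝ}
    (hG : Measurable G) (hG0 : ∀ x, 0 ≤ G x) (F : α → ℝ) :
    ∫⁻ x, ENNReal.ofReal (G x * F x) ∂ν =
      ∫⁻ x, ENNReal.ofReal (F x) ∂ν.withDensity fun x => ENNReal.ofReal (G x) := by
  rw [lintegral_withDensity_eq_lintegral_mul_non_measurable _ hG.ennreal_ofReal
    (Filter.Eventually.of_forall fun x => ENNReal.ofReal_lt_top)]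
  simp [ENNReal.ofReal_mul (hG0 _)]

theorem integral_smul_eq_integral_withDensity_ofReal {α F : Type*} [MeasurableSpace α]
    [NormedAddCommGroup F] [NormedSpace ℝ F] (ν : Measure α) {G : α → ℝ} (hG : Measurable G)
    (hG0 : ∀ x, 0 ≤ G x) (H : α → F) :
    ∫ x, G x • H x ∂ν = ∫ x, H x ∂ν.withDensity fun x => ENNReal.ofReal (G x) := by
  rw [integral_withDensity_eq_integral_toReal_smul hG.ennreal_ofReal
    (Filter.Eventually.of_forall fun x => ENNReal.ofReal_lt_top)]
  simp [ENNReal.toReal_ofReal (hG0 _)]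

section GaussDens

variable {d : ℕ} {s : ℝ}

theorem gaussDens_nonneg (hs : 0 < s) (y : EuclideanSpace ℝ (Fin d)) : 0 ≤ gaussDens d s y := by
  unfold gaussDens
  positivity

theorem continuous_gaussDens : Continuous (gaussDens d s) := by
  unfold gaussDens
  fun_prop

theorem integral_gaussDens (hs : 0 < s) : ∫ y, gaussDens d s y = 1 := by
  unfold gaussDens
  have h := GaussianFourier.integral_rexp_neg_mul_sq_norm (V := EuclideanSpace ℝ (Fin d))
    (b := (2 * s)⁻¹) (by positivity)
  rw [integral_const_mul]
  simp_rw [neg_mul, inv_mul_eq_div, ← neg_div] at h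
  rw [h, finrank_euclideanSpace_fin, div_inv_eq_mul, mul_left_comm, ← mul_assoc,
    ← rpow_add (by positivity)]
  simp [neg_div]

theorem integrable_gaussDens (hs : 0 < s) : Integrable (gaussDens d s) :=
  .of_integral_ne_zero (by rw [integral_gaussDens hs]; exact one_ne_zero)

/-- The centered Gaussian measure with density `gaussDens d s`. -/
noncomputable def gaussMeasure (d : ℕ) (s : ℝ) : Measure (EuclideanSpace ℝ (Fin d)) :=
  volume.withDensity fun y => ENNReal.ofReal (gaussDens d s y)

theorem isProbabilityMeasure_gaussMeasure (hs : 0 < s) :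
    IsProbabilityMeasure (gaussMeasure d s) := by
  constructor
  rw [gaussMeasure, withDensity_apply _ MeasurableSet.univ, setLIntegral_univ,
    ← ofReal_integral_eq_lintegral_ofReal (integrable_gaussDens hs)
      (Filter.Eventually.of_forall (gaussDens_nonneg hs)), integral_gaussDens hs,
    ENNReal.ofReal_one]

theorem integral_gaussMeasure (hs : 0 < s) (F : EuclideanSpace ℝ (Fin d) → ℝ) :
    ∫ y, F y ∂gaussMeasure d s = ∫ y, gaussDens d s y * F y :=
  (integral_smul_eq_integral_withDensity_ofReal _ continuous_gaussDens.measurable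
    (gaussDens_nonneg hs) F).symm

theorem integrable_gaussMeasure (hs : 0 < s) {F : EuclideanSpace ℝ (Fin d) → ℝ}
    (hF : Integrable fun y => gaussDens d s y * F y) : Integrable F (gaussMeasure d s) := by
  rw [gaussMeasure, integrable_withDensity_iff continuous_gaussDens.measurable.ennreal_ofReal
    (Filter.Eventually.of_forall fun x => ENNReal.ofReal_lt_top)]
  simpa only [ENNReal.toReal_ofReal (gaussDens_nonneg hs _), mul_comm] using hF

theorem pi_gaussMeasure (hs : 0 < s) (n : ℕ) :
    Measure.pi (fun _ : Fin n => gaussMeasure d s) =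
      volume.withDensity fun y => ENNReal.ofReal (∏ i, gaussDens d s (y i)) :=
  pi_withDensity_ofReal _ (integrable_gaussDens hs) (gaussDens_nonneg hs)

theorem continuous_prod_gaussDens (n : ℕ) :
    Continuous fun y : Fin n → EuclideanSpace ℝ (Fin d) => ∏ i, gaussDens d s (y i) :=
  continuous_finsetProd _ fun i _ => continuous_gaussDens.comp (continuous_apply i)

theorem lintegral_prod_gaussDens (hs : 0 < s) (n : ℕ)
    (F : (Fin n → EuclideanSpace ℝ (Fin d)) → ℝ) :
    ∫⁻ y, ENNReal.ofReal ((∏ i, gaussDens d s (y i)) * F y) =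
      ∫⁻ y, ENNReal.ofReal (F y) ∂Measure.pi fun _ => gaussMeasure d s := by
  rw [pi_gaussMeasure hs, lintegral_ofReal_mul_eq _ (continuous_prod_gaussDens n).measurable
    fun y => Finset.prod_nonneg fun i _ => gaussDens_nonneg hs _]

theorem integral_prod_gaussDens {F : Type*} [NormedAddCommGroup F] [NormedSpace ℝ F] (hs : 0 < s)
    (n : ℕ) (H : (Fin n → EuclideanSpace ℝ (Fin d)) → F) :
    ∫ y, (∏ i, gaussDens d s (y i)) • H y =
      ∫ y, H y ∂Measure.pi fun _ => gaussMeasure d s := by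
  rw [pi_gaussMeasure hs, integral_smul_eq_integral_withDensity_ofReal _
    (continuous_prod_gaussDens n).measurable
    fun y => Finset.prod_nonneg fun i _ => gaussDens_nonneg hs _]

end GaussDens

/-- Gaussian averages of `ψ(y) e^{-W(e^t (z - y))}` as integrals against `e^{-W}`. -/
theorem integral_gaussMeasure_mul_exp {d : ℕ} (W ψ : EuclideanSpace ℝ (Fin d) → ℝ) {t : ℝ}
    (ht : 0 < t) (z : EuclideanSpace ℝ (Fin d)) (hZ : (∫ x, exp (-W x)) ≠ 0) :
    ∫ y, ψ y * exp (-W (exp t • (z - y))) ∂gaussMeasure d (1 - exp (-2 * t)) =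
      ((2 * π * (1 - exp (-2 * t))) ^ (-(d : ℝ) / 2) *
        ∫ x, exp (-‖z - exp (-t) • x‖ ^ 2 / (2 * (1 - exp (-2 * t)))) *
          ψ (z - exp (-t) • x) * (exp (-W x) / ∫ y, exp (-W y))) *
        (∫ x, exp (-W x)) * exp (-(t * d)) := by
  have h := integral_mul_comp_smul_sub (exp_pos t)
    (fun y => gaussDens d (1 - exp (-2 * t)) y * ψ y) (fun x => exp (-W x)) z
  simp only [mul_assoc] at h
  rw [integral_gaussMeasure (ouVariance_pos ht), h, ← exp_neg, ← exp_nat_mul, ← exp_neg,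
    mul_comm (exp _), mul_comm (d : ℝ) t]
  congr 1
  generalize (∫ x, exp (-W x)) = Z at hZ ⊢
  rw [← integral_const_mul, ← integral_mul_const]
  congr 1 with x
  unfold gaussDens
  field_simp

theorem integrable_gaussMeasure_mul_exp {d : ℕ} {W ψ : EuclideanSpace ℝ (Fin d) → ℝ}
    (hW : Integrable fun x => exp (-W x)) {t : ℝ} (ht : 0 < t) (z : EuclideanSpace ℝ (Fin d))
    (hψ : Continuous ψ) {A : ℝ}
    (hA : ∀ u, ‖exp (-‖u‖ ^ 2 / (2 * (1 - exp (-2 * t)))) * ψ u‖ ≤ A) :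
    Integrable (fun y => ψ y * exp (-W (exp t • (z - y))))
      (gaussMeasure d (1 - exp (-2 * t))) := by
  refine integrable_gaussMeasure (ouVariance_pos ht) ?_
  simp_rw [← mul_assoc]
  refine integrable_mul_comp_smul_sub (W := fun x => exp (-W x))
    (ψ := fun y => gaussDens d (1 - exp (-2 * t)) y * ψ y) (exp_pos t) z ?_
  rw [← exp_neg]
  have h := (hW.smul_comp_sub_smul (by fun_prop) hA (exp (-t)) z).const_mul
    ((2 * π * (1 - exp (-2 * t))) ^ (-(d : ℝ) / 2))
  refine h.congr (Filter.Eventually.of_forall fun x => ?_)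
  simp only [gaussDens, smul_eq_mul]
  ring

/-- variance of the Monte-Carlo estimators. With `y₁, …, yₙ` i.i.d.
`N(0, (1-e^{-2t}) I_d)` (expectations written against the product Gaussian density),
`N = E[N̂]`, `D = E[D̂]`, one has
`E[‖N̂ - N‖²] ≤ (1/n) p_t^{2V}(z) Z_{2V} e^{-td} (Δ log p_t^{2V}(z) + d/(1-e^{-2t})
  + ‖∇ log p_t^{2V}(z)‖²)` and `E[(D̂ - D)²] ≤ (1/n) p_t^{2V}(z) Z_{2V} e^{-td}`. -/
theorem variance_of_estimators
    (d : ℕ) (hd : 1 ≤ d) (V : EuclideanSpace ℝ (Fin d) → ℝ)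
    (hV : Continuous V)
    (hint : Integrable fun x : EuclideanSpace ℝ (Fin d) => exp (-V x))
    (hint2 : Integrable fun x : EuclideanSpace ℝ (Fin d) => exp (-(2 * V x)))
    (t : ℝ) (ht : 0 < t) (z : EuclideanSpace ℝ (Fin d)) (n : ℕ) (hn : 1 ≤ n) :
    (∫⁻ y : Fin n → EuclideanSpace ℝ (Fin d),
        ENNReal.ofReal ((∏ i, gaussDens d (1 - exp (-2 * t)) (y i)) *
          ‖hatN d n V t z y -
            ∫ y' : Fin n → EuclideanSpace ℝ (Fin d),
              (∏ i, gaussDens d (1 - exp (-2 * t)) (y' i)) • hatN d n V t z y'‖ ^ 2) ≤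
      ENNReal.ofReal ((1 / n) *
        (ouDensity d (fun x => 2 * V x) t z *
          (∫ x : EuclideanSpace ℝ (Fin d), exp (-(2 * V x))) * exp (-(t * d))) *
        ((∑ i : Fin d,
            iteratedFDeriv ℝ 2 (fun w => Real.log (ouDensity d (fun x => 2 * V x) t w)) z
              ![EuclideanSpace.single i 1, EuclideanSpace.single i 1]) +
          d / (1 - exp (-2 * t)) +
          ‖gradient (fun w => Real.log (ouDensity d (fun x => 2 * V x) t w)) z‖ ^ 2))) ∧
    ∫⁻ y : Fin n → EuclideanSpace ℝ (Fin d),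
        ENNReal.ofReal ((∏ i, gaussDens d (1 - exp (-2 * t)) (y i)) *
          (hatD d n V t z y -
            ∫ y' : Fin n → EuclideanSpace ℝ (Fin d),
              (∏ i, gaussDens d (1 - exp (-2 * t)) (y' i)) * hatD d n V t z y') ^ 2) ≤
      ENNReal.ofReal ((1 / n) *
        (ouDensity d (fun x => 2 * V x) t z *
          (∫ x : EuclideanSpace ℝ (Fin d), exp (-(2 * V x))) * exp (-(t * d)))) := by
  have hs := ouVariance_pos ht
  have := isProbabilityMeasure_gaussMeasure (d := d) hs
  have hZ : (∫ x : EuclideanSpace ℝ (Fin d), exp (-(2 * V x))) ≠ 0 := (integral_exp_pos hint2).ne'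
  have hn0 : (n : ℝ) ≠ 0 := by positivity
  have hsq : ∀ x, exp (-V x) ^ 2 = exp (-(2 * V x)) := fun x => by
    rw [← exp_nat_mul]
    congr 1
    push_cast
    ring
  constructor
  · have hI := integrable_gaussMeasure_mul_exp (W := fun x => 2 * V x) (ψ := fun u => ‖u‖ ^ 2)
      hint2 ht z (by fun_prop) (A := 2 * (1 - exp (-2 * t))) fun u => by
        rw [norm_of_nonneg (by positivity)]
        exact gauss_mul_norm_sq_le hs u
    have hf : ∀ y, ‖exp (-V (exp t • (z - y))) • y‖ ^ 2 =
        ‖y‖ ^ 2 * exp (-(2 * V (exp t • (z - y)))) := fun y => by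
      rw [norm_smul, mul_pow, norm_of_nonneg (exp_pos _).le, hsq, mul_comm]
    have key := lintegral_norm_sq_sub_mean_le (gaussMeasure d (1 - exp (-2 * t)))
      (f := fun y => exp (-V (exp t • (z - y))) • y)
      (Continuous.measurable (by fun_prop)) (by simpa only [hf] using hI) n
      (-(1 / (n * (1 - exp (-2 * t)))))
    rw [integral_prod_gaussDens hs, lintegral_prod_gaussDens hs]
    refine key.trans_eq ?_
    congr 1
    have hlap := ouDensity_mul_laplacian_log hint2 ht z
    have hmean := integral_gaussMeasure_mul_exp (fun x => 2 * V x)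
      (fun u => ‖u‖ ^ 2 / (1 - exp (-2 * t)) ^ 2) ht z hZ
    rw [← hlap] at hmean
    simp only [hf]
    have hdiv : ∫ y, ‖y‖ ^ 2 * exp (-(2 * V (exp t • (z - y)))) ∂gaussMeasure d (1 - exp (-2 * t)) =
        (1 - exp (-2 * t)) ^ 2 * ∫ y, ‖y‖ ^ 2 / (1 - exp (-2 * t)) ^ 2 *
          exp (-(2 * V (exp t • (z - y)))) ∂gaussMeasure d (1 - exp (-2 * t)) := by
      rw [← integral_const_mul]
      congr 1 with y
      rw [← mul_assoc, mul_div_cancel₀ _ (pow_ne_zero 2 hs.ne')]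
    rw [hdiv, hmean]
    have hs0 := hs.ne'
    generalize 1 - exp (-2 * t) = s at hs0 ⊢
    field_simp
  · have hI := integrable_gaussMeasure_mul_exp (W := fun x => 2 * V x) (ψ := fun _ => 1)
      hint2 ht z continuous_const (A := 1) fun u => by
        rw [mul_one, norm_of_nonneg (exp_pos _).le]
        exact gauss_le_one hs u
    simp only [one_mul] at hI
    have hm : Continuous fun y => exp (-V (exp t • (z - y))) := by fun_prop
    have key := lintegral_sq_sub_mean_le (gaussMeasure d (1 - exp (-2 * t)))
      ((memLp_two_iff_integrable_sq hm.aestronglyMeasurable).2 (by simpa only [hsq] using hI)) n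
      (1 / n)
    simp_rw [← smul_eq_mul (∏ i, gaussDens d (1 - exp (-2 * t)) _) (hatD d n V t z _)]
    rw [integral_prod_gaussDens hs, lintegral_prod_gaussDens hs]
    refine key.trans_eq ?_
    congr 1
    have hmean := integral_gaussMeasure_mul_exp (fun x => 2 * V x) (fun _ => 1) ht z hZ
    simp only [one_mul, mul_one] at hmean
    simp only [hsq]
    rw [hmean, ouDensity]
    field_simp
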